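/- Convergence of the discrete determinant to Δ. Fix k ∈ ℂ. For every sequence of partitions 0 = x₀ < x₁ < ⋯ < x_N = 1 (N → ∞) whose mesh L = max_p Δx_p tends to 0, the corresponding quantities D_N(k) converge to Δ(k) = ∑_{n=0}^{∞} S_n^{(0,1)}(k). -/

import Mathlib

open MeasureTheory Filter

noncomputable section

/-- Nodes of the simplex: `y₀ = a`, `y_{n+1} = b`, interior nodes from `y`. -/
def nodes (a b : ℝ) (n : ℕ) (y : Fin n → ℝ) (p : ℕ) : ℝ :=
  if h : 1 ≤ p ∧ p ≤ n then y ⟨p - 1, by omega⟩ else if p = 0 then a else b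

/-- The ordered simplex `a ≤ y₁ ≤ ⋯ ≤ y_n ≤ b`. -/
def simplex (a b : ℝ) (n : ℕ) : Set (Fin n → ℝ) :=
  {y | Monotone y ∧ ∀ i, y i ∈ Set.Icc a b}

/-- The alternating phase `∑_{p=0}^{n} (−1)^p ∫_{y_p}^{y_{p+1}} dξ/σ(ξ)`. -/
def phase (σ : ℝ → ℝ) (a b : ℝ) (n : ℕ) (y : Fin n → ℝ) : ℝ :=
  ∑ p ∈ Finset.range (n + 1),
    (-1 : ℝ) ^ p * ∫ ξ in (nodes a b n y p)..(nodes a b n y (p + 1)), 1 / σ ξ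

/-- The integrand defining `S_n^{(a,b)}(k)`. -/
def Sintegrand (σ : ℝ → ℝ) (a b : ℝ) (n : ℕ) (k : ℂ) (y : Fin n → ℝ) : ℂ :=
  ((∏ p, deriv σ (y p) / σ (y p) : ℝ) : ℂ) * Complex.sin (k * ((phase σ a b n y : ℝ) : ℂ))

/-- `S_n^{(a,b)}(k)`. -/
def S (σ : ℝ → ℝ) (a b : ℝ) (n : ℕ) (k : ℂ) : ℂ :=
  ((2 : ℂ) ^ n)⁻¹ * ∫ y in simplex a b n, Sintegrand σ a b n k y

/-- `Δ(k) = ∑_{n=0}^∞ S_n^{(0,1)}(k)`. -/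
def Δfun (σ : ℝ → ℝ) (k : ℂ) : ℂ := ∑' n, S σ 0 1 n k

/-- `σ` is absolutely continuous on `[0,1]`: fundamental-theorem-of-calculus
characterization with integrable derivative. -/
def sigmaAC (σ : ℝ → ℝ) : Prop :=
  IntegrableOn (deriv σ) (Set.Icc 0 1) ∧
    ∀ x ∈ Set.Icc (0 : ℝ) 1, σ x = σ 0 + ∫ t in (0 : ℝ)..x, deriv σ t

/-- Read off the entry `ℓ_p` (for `1 ≤ p ≤ N`) of a binary vector `ℓ ∈ {0,1}^N`,
encoded as `ℓ : Fin N → Bool`; out-of-range indices give `false`. -/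
def entry (N : ℕ) (ℓ : Fin N → Bool) (p : ℕ) : Bool :=
  if h : 1 ≤ p ∧ p ≤ N then ℓ ⟨p - 1, by omega⟩ else false

/-- The discrete determinant
`D_N(k) = ∑_{ℓ ∈ {0,1}^N, ℓ₁=0} (∏_{p=1}^{N-1} Λ_p^±(ℓ)/Λ_p^+) sin(k ∑_{p=1}^N (−1)^{ℓ_p} Δx_p/σ_p)`
for a partition `0 = x₀ < ⋯ < x_N = 1`, where `σ_p = σ(x_p)`, `Δx_p = x_p − x_{p−1}`,
`Λ_p^±(ℓ) = σ_{p+1} + (−1)^{ℓ_p+ℓ_{p+1}} σ_p` and `Λ_p^+ = σ_{p+1} + σ_p`. -/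
def Dsum (σ : ℝ → ℝ) (k : ℂ) (N : ℕ) (x : ℕ → ℝ) : ℂ :=
  ∑ ℓ : Fin N → Bool,
    if entry N ℓ 1 = false then
      ((∏ p ∈ Finset.Ico 1 N,
          (σ (x (p + 1)) +
            (if entry N ℓ p = entry N ℓ (p + 1) then σ (x p) else -σ (x p))) /
            (σ (x (p + 1)) + σ (x p)) : ℝ) : ℂ) *
        Complex.sin (k * ((∑ p ∈ Finset.Icc 1 N,
          (if entry N ℓ p then (-1 : ℝ) else 1) * (x p - x (p - 1)) / σ (x p) : ℝ) : ℂ))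
    else 0

/-- Iterated integrals `∫_{0 ≤ y₁ ≤ ⋯ ≤ y_n ≤ x} f₀(y₁) ⋯ f_{n-1}(y_n)`, as a recursion on `n`. -/
def iterInt (f : ℕ → ℝ → ℂ) : ℕ → ℝ → ℂ
  | 0 => fun _ => 1
  | n + 1 => fun x => ∫ y in (0 : ℝ)..x, f n y * iterInt f n y

lemma continuous_iterInt {f : ℕ → ℝ → ℂ} (hf : ∀ n, Continuous (f n)) (n : ℕ) :
    Continuous (iterInt f n) := by
  induction n with
  | zero => exact continuous_const
  | succ n ih =>
    exact intervalIntegral.continuous_primitive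
      (fun a b => ((hf n).mul ih).intervalIntegrable a b) 0

lemma norm_iterInt_le {f : ℕ → ℝ → ℂ} {B : ℝ}
    (hB : ∀ n, ∀ y ∈ Set.Icc (0 : ℝ) 1, ‖f n y‖ ≤ B) (n : ℕ) {x : ℝ}
    (hx : x ∈ Set.Icc (0 : ℝ) 1) : ‖iterInt f n x‖ ≤ B ^ n * x ^ n / n.factorial := by
  induction n generalizing x with
  | zero => simp [iterInt]
  | succ n ih =>
    have hB0 : 0 ≤ B := (norm_nonneg _).trans (hB 0 0 (by simp))
    have h : ‖iterInt f (n + 1) x‖ ≤ ∫ y in (0 : ℝ)..x, B * (B ^ n * y ^ n / n.factorial) := by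
      refine intervalIntegral.norm_integral_le_of_norm_le hx.1 (.of_forall fun t ht => ?_)
        ((by fun_prop : Continuous _).intervalIntegrable _ _)
      have ht' : t ∈ Set.Icc (0 : ℝ) 1 := ⟨ht.1.le, ht.2.trans hx.2⟩
      rw [norm_mul]
      exact mul_le_mul (hB n t ht') (ih ht') (norm_nonneg _) hB0
    refine h.trans (le_of_eq ?_)
    have : ∀ y : ℝ, B * (B ^ n * y ^ n / n.factorial) = (B ^ (n + 1) / n.factorial) * y ^ n :=
      fun y => by ring
    simp only [this, intervalIntegral.integral_const_mul, integral_pow, Nat.factorial_succ]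
    have := Nat.factorial_ne_zero n
    push_cast
    field_simp
    simp

lemma isClosed_pairs (b : ℝ) (n : ℕ) :
    IsClosed {q : ℝ × (Fin n → ℝ) | q.1 ∈ Set.Icc 0 b ∧ q.2 ∈ simplex 0 q.1 n} := by
  have h : {q : ℝ × (Fin n → ℝ) | q.1 ∈ Set.Icc 0 b ∧ q.2 ∈ simplex 0 q.1 n} =
      ({q | 0 ≤ q.1} ∩ {q | q.1 ≤ b}) ∩ ((⋂ i, ⋂ j, ⋂ (_ : i ≤ j), {q | q.2 i ≤ q.2 j}) ∩
        ⋂ i, ({q | 0 ≤ q.2 i} ∩ {q | q.2 i ≤ q.1})) := by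
    ext q
    simp [simplex, Monotone]
  rw [h]
  refine ((isClosed_le ?_ ?_).inter (isClosed_le ?_ ?_)).inter
    ((isClosed_iInter fun i => isClosed_iInter fun j => isClosed_iInter fun _ =>
      isClosed_le ?_ ?_).inter (isClosed_iInter fun i =>
        (isClosed_le ?_ ?_).inter (isClosed_le ?_ ?_))) <;> fun_prop

lemma isCompact_pairs (b : ℝ) (n : ℕ) :
    IsCompact {q : ℝ × (Fin n → ℝ) | q.1 ∈ Set.Icc 0 b ∧ q.2 ∈ simplex 0 q.1 n} := by
  refine (isCompact_Icc (a := ((0 : ℝ), (fun _ => 0 : Fin n → ℝ)))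
    (b := (b, fun _ => b))).of_isClosed_subset (isClosed_pairs b n) ?_
  rintro ⟨t, z⟩ ⟨ht, -, hz⟩
  exact ⟨⟨ht.1, fun i => (hz i).1⟩, ht.2, fun i => (hz i).2.trans ht.2⟩

lemma mem_simplex_succ_iff (b : ℝ) (n : ℕ) (y : Fin (n + 1) → ℝ) :
    y ∈ simplex 0 b (n + 1) ↔ y (Fin.last n) ∈ Set.Icc 0 b ∧
      (fun i : Fin n => y i.castSucc) ∈ simplex 0 (y (Fin.last n)) n := by
  constructor
  · rintro ⟨h1, h2⟩
    exact ⟨h2 _, fun i j hij => h1 (Fin.castSucc_le_castSucc_iff.mpr hij),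
      fun i => ⟨(h2 _).1, h1 (Fin.le_last _)⟩⟩
  · rintro ⟨h1, h2, h3⟩
    refine ⟨fun i j hij => ?_, fun i => ?_⟩
    · induction j using Fin.lastCases with
      | last =>
        induction i using Fin.lastCases with
        | last => exact le_rfl
        | cast i => exact (h3 i).2
      | cast j =>
        induction i using Fin.lastCases with
        | last => exact absurd hij (by simp)
        | cast i => exact h2 (Fin.castSucc_le_castSucc_iff.mp hij)
    · induction i using Fin.lastCases with
      | last => exact h1
      | cast i => exact ⟨(h3 i).1, (h3 i).2.trans h1.2⟩

lemma setIntegral_simplex_prod {f : ℕ → ℝ → ℂ} (hf : ∀ n, Continuous (f n)) (n : ℕ) {b : ℝ}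
    (hb : 0 ≤ b) : ∫ y in simplex 0 b n, ∏ i : Fin n, f i (y i) = iterInt f n b := by
  induction n generalizing b with
  | zero =>
    have : simplex 0 b 0 = Set.univ := by
      ext y; simp [simplex, Subsingleton.monotone]
    simp [this, iterInt, measureReal_def, volume_pi]
  | succ n ih =>
    set s := {q : ℝ × (Fin n → ℝ) | q.1 ∈ Set.Icc 0 b ∧ q.2 ∈ simplex 0 q.1 n} with hs
    let g : ℝ × (Fin n → ℝ) → ℂ := fun q => f n q.1 * ∏ i : Fin n, f i (q.2 i)
    have hg : Continuous g := by fun_prop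
    have hpre : simplex 0 b (n + 1) =
        MeasurableEquiv.piFinSuccAbove (fun _ => ℝ) (Fin.last n) ⁻¹' s := by
      ext y
      rw [mem_simplex_succ_iff]
      simp [hs, MeasurableEquiv.piFinSuccAbove, Fin.init_def]
    have h1 : ∫ y in simplex 0 b (n + 1), ∏ i : Fin (n + 1), f i (y i) = ∫ q in s, g q := by
      rw [← (volume_preserving_piFinSuccAbove (fun _ => ℝ) (Fin.last n)).setIntegral_preimage_emb
        (MeasurableEquiv.measurableEmbedding _), hpre]
      refine integral_congr_ae (.of_forall fun y => ?_)
      simp [g, MeasurableEquiv.piFinSuccAbove, Fin.prod_univ_castSucc, mul_comm, Fin.init_def]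
    have hms : MeasurableSet s := (isClosed_pairs b n).measurableSet
    have hint : Integrable (s.indicator g) (volume.prod volume) :=
      (integrable_indicator_iff hms).mpr
        (hg.continuousOn.integrableOn_compact (isCompact_pairs b n))
    rw [h1, ← integral_indicator hms, Measure.volume_eq_prod, integral_prod _ hint]
    have h2 : ∀ t : ℝ, ∫ z, s.indicator g (t, z) =
        (Set.Icc 0 b).indicator (fun t => f n t * iterInt f n t) t := by
      intro t
      by_cases ht : t ∈ Set.Icc 0 b
      · have hmt : MeasurableSet (simplex 0 t n) := by
          have : simplex 0 t n = Prod.mk t ⁻¹' s := by ext z; simp [hs, ht.1, ht.2]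
          exact this ▸ hms.preimage measurable_prodMk_left
        have : (fun z => s.indicator g (t, z)) = (simplex 0 t n).indicator (fun z => g (t, z)) := by
          ext z
          have : (t, z) ∈ s ↔ z ∈ simplex 0 t n := by simp [hs, ht.1, ht.2]
          by_cases hz : z ∈ simplex 0 t n
          · rw [Set.indicator_of_mem (this.mpr hz), Set.indicator_of_mem hz]
          · rw [Set.indicator_of_notMem (this.not.mpr hz), Set.indicator_of_notMem hz]
        rw [this, integral_indicator hmt, Set.indicator_of_mem ht, ← ih ht.1,
          ← integral_const_mul]
      · rw [Set.indicator_of_notMem ht]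
        refine integral_eq_zero_of_ae (.of_forall fun z => ?_)
        exact Set.indicator_of_notMem (fun h => ht h.1) _
    simp only [h2]
    rw [integral_indicator measurableSet_Icc, integral_Icc_eq_integral_Ioc,
      ← intervalIntegral.integral_of_le hb]
    rfl

/-- The sum of the iterated integrals of even order. -/
def evenSum (f : ℕ → ℝ → ℂ) (x : ℝ) : ℂ := ∑' m, iterInt f (2 * m) x

/-- The sum of the iterated integrals of odd order. -/
def oddSum (f : ℕ → ℝ → ℂ) (x : ℝ) : ℂ := ∑' m, iterInt f (2 * m + 1) x

section Series

variable {f : ℕ → ℝ → ℂ} {B : ℝ}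

lemma norm_iterInt_le_const (hB : ∀ n, ∀ y ∈ Set.Icc (0 : ℝ) 1, ‖f n y‖ ≤ B) (n : ℕ) {x : ℝ}
    (hx : x ∈ Set.Icc (0 : ℝ) 1) : ‖iterInt f n x‖ ≤ B ^ n / n.factorial := by
  have hB0 : 0 ≤ B := (norm_nonneg _).trans (hB 0 0 (by simp))
  refine (norm_iterInt_le hB n hx).trans ?_
  gcongr
  exact mul_le_of_le_one_right (by positivity) (pow_le_one₀ hx.1 hx.2)

lemma summable_iterInt_comp (hB : ∀ n, ∀ y ∈ Set.Icc (0 : ℝ) 1, ‖f n y‖ ≤ B) {φ : ℕ → ℕ}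
    (hφ : φ.Injective) {x : ℝ} (hx : x ∈ Set.Icc (0 : ℝ) 1) :
    Summable fun m => iterInt f (φ m) x :=
  .of_norm_bounded ((Real.summable_pow_div_factorial B).comp_injective hφ)
    fun _ => norm_iterInt_le_const hB _ hx

lemma continuousOn_tsum_iterInt (hf : ∀ n, Continuous (f n))
    (hB : ∀ n, ∀ y ∈ Set.Icc (0 : ℝ) 1, ‖f n y‖ ≤ B) {φ : ℕ → ℕ} (hφ : φ.Injective) :
    ContinuousOn (fun x => ∑' m, iterInt f (φ m) x) (Set.Icc 0 1) :=
  continuousOn_tsum (fun _ => (continuous_iterInt hf _).continuousOn)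
    ((Real.summable_pow_div_factorial B).comp_injective hφ)
    fun _ _ hx => norm_iterInt_le_const hB _ hx

lemma hasSum_iterInt_succ (hf : ∀ n, Continuous (f n))
    (hB : ∀ n, ∀ y ∈ Set.Icc (0 : ℝ) 1, ‖f n y‖ ≤ B) {φ : ℕ → ℕ} (hφ : φ.Injective)
    {g : ℝ → ℂ} (hg : ∀ m, f (φ m) = g) {x : ℝ} (hx : x ∈ Set.Icc (0 : ℝ) 1) :
    HasSum (fun m => iterInt f (φ m + 1) x)
      (∫ y in (0 : ℝ)..x, g y * ∑' m, iterInt f (φ m) y) := by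
  have hB0 : 0 ≤ B := (norm_nonneg _).trans (hB 0 0 (by simp))
  have hsum : Summable fun m => B * (B ^ φ m / (φ m).factorial) :=
    ((Real.summable_pow_div_factorial B).comp_injective hφ).mul_left B
  refine intervalIntegral.hasSum_integral_of_dominated_convergence
    (fun m _ => B * (B ^ φ m / (φ m).factorial)) (fun m => ?_) (fun m => ?_)
    (.of_forall fun _ _ => hsum) (by simp) ?_
  · exact ((hf _).mul (continuous_iterInt hf _)).aestronglyMeasurable
  · refine .of_forall fun t ht => ?_
    rw [Set.uIoc_of_le hx.1] at ht
    have ht' : t ∈ Set.Icc (0 : ℝ) 1 := ⟨ht.1.le, ht.2.trans hx.2⟩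
    rw [norm_mul]
    exact mul_le_mul (hB _ t ht') (norm_iterInt_le_const hB _ ht') (norm_nonneg _) hB0
  · refine .of_forall fun t ht => ?_
    rw [Set.uIoc_of_le hx.1] at ht
    have ht' : t ∈ Set.Icc (0 : ℝ) 1 := ⟨ht.1.le, ht.2.trans hx.2⟩
    simp only [hg]
    exact (summable_iterInt_comp hB hφ ht').hasSum.mul_left _

lemma oddSum_eq_integral (hf : ∀ n, Continuous (f n))
    (hB : ∀ n, ∀ y ∈ Set.Icc (0 : ℝ) 1, ‖f n y‖ ≤ B) (hper : ∀ n, f (n + 2) = f n) {x : ℝ}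
    (hx : x ∈ Set.Icc (0 : ℝ) 1) : oddSum f x = ∫ y in (0 : ℝ)..x, f 0 y * evenSum f y := by
  have hg : ∀ m, f (2 * m) = f 0 := fun m => by
    induction m with
    | zero => rfl
    | succ m ih => rw [mul_add, mul_one, hper, ih]
  exact (hasSum_iterInt_succ hf hB (φ := fun m => 2 * m) (fun a b h => by simpa using h) hg
    hx).tsum_eq

lemma evenSum_eq_integral (hf : ∀ n, Continuous (f n))
    (hB : ∀ n, ∀ y ∈ Set.Icc (0 : ℝ) 1, ‖f n y‖ ≤ B) (hper : ∀ n, f (n + 2) = f n) {x : ℝ}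
    (hx : x ∈ Set.Icc (0 : ℝ) 1) :
    evenSum f x = 1 + ∫ y in (0 : ℝ)..x, f 1 y * oddSum f y := by
  have hg : ∀ m, f (2 * m + 1) = f 1 := fun m => by
    induction m with
    | zero => rfl
    | succ m ih => rw [show 2 * (m + 1) + 1 = 2 * m + 1 + 2 by ring, hper, ih]
  rw [evenSum, (summable_iterInt_comp hB (φ := fun m => 2 * m) (fun a b h => by simpa using h)
    hx).tsum_eq_zero_add]
  congr 1
  exact (hasSum_iterInt_succ hf hB (φ := fun m => 2 * m + 1) (fun a b h => by simpa using h) hg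
    hx).tsum_eq

end Series

/-- `τ(x) = ∫₀ˣ dξ/s(ξ)`. -/
def travelTime (s : ℝ → ℝ) (x : ℝ) : ℝ := ∫ ξ in (0 : ℝ)..x, 1 / s ξ

/-- The coupling coefficient `d(a)/(s(b)+s(e)) · exp(c t)`. -/
def coupling (s d : ℝ → ℝ) (c : ℂ) (a b e t : ℝ) : ℂ :=
  ((d a / (s b + s e) : ℝ) : ℂ) * Complex.exp (c * t)

/-- The kernels `d/(2s) · exp(± c τ)` of the iterated integrals, with sign `(-1)^n`. -/
def kernelSeq (s d : ℝ → ℝ) (c : ℂ) (n : ℕ) (y : ℝ) : ℂ :=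
  coupling s d (c * (-1) ^ n) y y y (travelTime s y)

section Kernels

variable {s d : ℝ → ℝ}

lemma continuous_one_div (hs : Continuous s) (hpos : ∀ x, 0 < s x) :
    Continuous fun x => 1 / s x :=
  continuous_const.div hs fun x => (hpos x).ne'

lemma continuous_travelTime (hs : Continuous s) (hpos : ∀ x, 0 < s x) :
    Continuous (travelTime s) :=
  intervalIntegral.continuous_primitive
    (fun _ _ => (continuous_one_div hs hpos).intervalIntegrable _ _) 0

lemma travelTime_sub (hs : Continuous s) (hpos : ∀ x, 0 < s x) (a b : ℝ) :
    travelTime s b - travelTime s a = ∫ ξ in a..b, 1 / s ξ :=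
  intervalIntegral.integral_interval_sub_left
    ((continuous_one_div hs hpos).intervalIntegrable _ _)
    ((continuous_one_div hs hpos).intervalIntegrable _ _)

lemma continuous_coupling (hs : Continuous s) (hpos : ∀ x, 0 < s x) (hd : Continuous d) (c : ℂ) :
    Continuous fun q : ℝ × ℝ × ℝ × ℝ => coupling s d c q.1 q.2.1 q.2.2.1 q.2.2.2 := by
  unfold coupling
  refine .mul (Complex.continuous_ofReal.comp ?_) (by fun_prop)
  exact .div (by fun_prop) (by fun_prop) fun q => (add_pos (hpos _) (hpos _)).ne'

lemma continuous_kernelSeq (hs : Continuous s) (hpos : ∀ x, 0 < s x) (hd : Continuous d) (c : ℂ)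
    (n : ℕ) : Continuous (kernelSeq s d c n) := by
  have h := continuous_travelTime hs hpos
  exact (continuous_coupling hs hpos hd (c * (-1) ^ n)).comp
    (by fun_prop : Continuous fun y => (y, y, y, travelTime s y))

lemma kernelSeq_add_two (c : ℂ) (n : ℕ) : kernelSeq s d c (n + 2) = kernelSeq s d c n := by
  ext y
  simp [kernelSeq, pow_add]

lemma exists_bound_kernelSeq (hs : Continuous s) (hpos : ∀ x, 0 < s x) (hd : Continuous d)
    (c : ℂ) : ∃ B : ℝ, ∀ n, ∀ y ∈ Set.Icc (0 : ℝ) 1, ‖kernelSeq s d c n y‖ ≤ B := by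
  have h := fun n => isCompact_Icc.exists_bound_of_continuousOn (s := Set.Icc (0 : ℝ) 1)
    (continuous_kernelSeq hs hpos hd c n).continuousOn
  obtain ⟨B₀, h₀⟩ := h 0
  obtain ⟨B₁, h₁⟩ := h 1
  refine ⟨max B₀ B₁, fun n => ?_⟩
  induction n using Nat.twoStepInduction with
  | zero => exact fun y hy => (h₀ y hy).trans (le_max_left _ _)
  | one => exact fun y hy => (h₁ y hy).trans (le_max_right _ _)
  | more n ih _ => rwa [kernelSeq_add_two]

lemma exists_bound_coupling (hs : Continuous s) (hpos : ∀ x, 0 < s x) (hd : Continuous d)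
    (c : ℂ) (M : ℝ) : ∃ C : ℝ, 0 ≤ C ∧ ∀ a ∈ Set.Icc (0 : ℝ) 1, ∀ b ∈ Set.Icc (0 : ℝ) 1,
      ∀ e ∈ Set.Icc (0 : ℝ) 1, ∀ t ∈ Set.Icc 0 M, ‖coupling s d c a b e t‖ ≤ C := by
  have hK : IsCompact (Set.Icc (0 : ℝ) 1 ×ˢ Set.Icc (0 : ℝ) 1 ×ˢ Set.Icc (0 : ℝ) 1 ×ˢ
    Set.Icc 0 M) := by
    exact isCompact_Icc.prod (isCompact_Icc.prod (isCompact_Icc.prod isCompact_Icc))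
  obtain ⟨C, hC⟩ := hK.exists_bound_of_continuousOn
    (continuous_coupling hs hpos hd c).continuousOn
  exact ⟨max C 0, le_max_right _ _, fun a ha b hb e he t ht =>
    (hC (a, b, e, t) ⟨ha, hb, he, ht⟩).trans (le_max_left _ _)⟩

/-- The local truncation error of one step of the discrete scheme. -/
lemma exists_step_error (hs : Continuous s) (hpos : ∀ x, 0 < s x) (hd : Continuous d) (c : ℂ)
    {M : ℝ} (hM : ∀ y ∈ Set.Icc (0 : ℝ) 1, travelTime s y ∈ Set.Icc 0 M) {W : ℝ → ℂ}
    (hW : ContinuousOn W (Set.Icc 0 1)) {ε : ℝ} (hε : 0 < ε) :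
    ∃ δ > 0, ∀ a b ξ t : ℝ, 0 ≤ a → a ≤ b → b ≤ 1 → b - a < δ → ξ ∈ Set.Icc a b →
      t ∈ Set.Icc 0 M → (∀ y ∈ Set.Icc a b, |t - travelTime s y| < δ) →
      ‖((b - a : ℝ) : ℂ) * coupling s d c ξ a b t * W a -
        ∫ y in a..b, coupling s d c y y y (travelTime s y) * W y‖ ≤ ε * (b - a) := by
  have hK : IsCompact ((Set.Icc (0 : ℝ) 1 ×ˢ Set.Icc (0 : ℝ) 1 ×ˢ Set.Icc (0 : ℝ) 1 ×ˢ
    Set.Icc 0 M) ×ˢ Set.Icc (0 : ℝ) 1) :=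
    (isCompact_Icc.prod (isCompact_Icc.prod (isCompact_Icc.prod isCompact_Icc))).prod
      isCompact_Icc
  have hcont : ContinuousOn (fun q : (ℝ × ℝ × ℝ × ℝ) × ℝ =>
      coupling s d c q.1.1 q.1.2.1 q.1.2.2.1 q.1.2.2.2 * W q.2) ((Set.Icc (0 : ℝ) 1 ×ˢ
      Set.Icc (0 : ℝ) 1 ×ˢ Set.Icc (0 : ℝ) 1 ×ˢ Set.Icc 0 M) ×ˢ Set.Icc (0 : ℝ) 1) :=
    ((continuous_coupling hs hpos hd c).comp continuous_fst).continuousOn.mul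
      (hW.comp continuousOn_snd fun q hq => hq.2)
  obtain ⟨δ, hδ, huc⟩ := Metric.uniformContinuousOn_iff.mp
    (hK.uniformContinuousOn_of_continuous hcont) ε hε
  refine ⟨δ, hδ, fun a b ξ t ha hab hb hbδ hξ ht htδ => ?_⟩
  have hτ := continuous_travelTime hs hpos
  have hint : IntervalIntegrable (fun y => coupling s d c y y y (travelTime s y) * W y)
      volume a b := by
    refine ContinuousOn.intervalIntegrable ?_
    rw [Set.uIcc_of_le hab]
    refine ContinuousOn.mul ?_ (hW.mono (Set.Icc_subset_Icc ha hb))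
    exact ((continuous_coupling hs hpos hd c).comp
      (by fun_prop : Continuous fun y => (y, y, y, travelTime s y))).continuousOn
  have heq : ((b - a : ℝ) : ℂ) * coupling s d c ξ a b t * W a -
      ∫ y in a..b, coupling s d c y y y (travelTime s y) * W y =
      ∫ y in a..b, (coupling s d c ξ a b t * W a -
        coupling s d c y y y (travelTime s y) * W y) := by
    rw [intervalIntegral.integral_sub (by simp) hint, intervalIntegral.integral_const,
      Complex.real_smul, mul_assoc]
  rw [heq]
  refine (intervalIntegral.norm_integral_le_of_norm_le_const (C := ε) fun y hy => ?_).trans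
    (by rw [abs_of_nonneg (by linarith)])
  rw [Set.uIoc_of_le hab] at hy
  have hy' : y ∈ Set.Icc a b := ⟨hy.1.le, hy.2⟩
  have hsub : ∀ z ∈ Set.Icc a b, z ∈ Set.Icc (0 : ℝ) 1 := Set.Icc_subset_Icc ha hb
  have hdist : ∀ z ∈ Set.Icc a b, dist z y < δ := fun z hz =>
    (Real.dist_le_of_mem_Icc hz hy').trans_lt hbδ
  have ha' : a ∈ Set.Icc a b := ⟨le_rfl, hab⟩
  have hb' : b ∈ Set.Icc a b := ⟨hab, le_rfl⟩
  have := huc ((ξ, a, b, t), a) ⟨⟨hsub _ hξ, hsub _ ha', hsub _ hb', ht⟩, hsub _ ha'⟩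
    ((y, y, y, travelTime s y), y)
    ⟨⟨hsub _ hy', hsub _ hy', hsub _ hy', hM _ (hsub _ hy')⟩, hsub _ hy'⟩ (by
      simp only [Prod.dist_eq, max_lt_iff]
      exact ⟨⟨hdist _ hξ, hdist _ ha', hdist _ hb', by simpa [Real.dist_eq] using htδ y hy'⟩,
        hdist _ ha'⟩)
  rw [dist_eq_norm] at this
  exact this.le

end Kernels

lemma le_mul_exp_of_step_le {N : ℕ} {e x : ℕ → ℝ} {C ε : ℝ} (hC : 0 ≤ C) (hε : 0 ≤ ε) (hx : 0 ≤ x 1)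
    (hmono : ∀ p, 1 ≤ p → p < N → x p ≤ x (p + 1)) (he : e 1 ≤ ε)
    (hstep : ∀ p, 1 ≤ p → p < N →
      e (p + 1) ≤ (1 + C * (x (p + 1) - x p)) * e p + ε * (x (p + 1) - x p))
    {p : ℕ} (hp : 1 ≤ p) (hpN : p ≤ N) : 0 ≤ x p ∧ e p ≤ ε * Real.exp ((C + 1) * x p) := by
  induction p, hp using Nat.le_induction with
  | base =>
    exact ⟨hx, he.trans (le_mul_of_one_le_right hε (Real.one_le_exp (by positivity)))⟩
  | succ p hp ih =>
    obtain ⟨hxp, ih⟩ := ih (by omega)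
    have hm := hmono p hp (by omega)
    refine ⟨hxp.trans hm, (hstep p hp (by omega)).trans ?_⟩
    set h := x (p + 1) - x p with hh
    have hh0 : 0 ≤ h := by linarith
    have hE : 1 ≤ Real.exp ((C + 1) * x p) := Real.one_le_exp (by positivity)
    have hsplit : Real.exp ((C + 1) * x (p + 1)) =
        Real.exp ((C + 1) * x p) * Real.exp ((C + 1) * h) := by
      rw [← Real.exp_add, hh]; ring_nf
    calc (1 + C * h) * e p + ε * h
        ≤ (1 + C * h) * (ε * Real.exp ((C + 1) * x p)) +
          ε * h * Real.exp ((C + 1) * x p) := by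
          exact add_le_add (by gcongr) (le_mul_of_one_le_right (by positivity) hE)
      _ = ε * Real.exp ((C + 1) * x p) * ((C + 1) * h + 1) := by ring
      _ ≤ ε * Real.exp ((C + 1) * x p) * Real.exp ((C + 1) * h) := by
          gcongr
          exact Real.add_one_le_exp _
      _ = _ := by rw [hsplit, mul_assoc]

/-- `x` restricts to a partition `0 = x₀ < ⋯ < x_N = 1` with steps smaller than `η`. -/
structure IsFinePartition (η : ℝ) (N : ℕ) (x : ℕ → ℝ) : Prop where
  one_le : 1 ≤ N
  zero : x 0 = 0
  last : x N = 1
  lt_succ : ∀ p < N, x p < x (p + 1)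
  step_lt : ∀ p < N, x (p + 1) - x p < η

namespace IsFinePartition

variable {η : ℝ} {N : ℕ} {x : ℕ → ℝ}

lemma le_of_le (h : IsFinePartition η N x) {p q : ℕ} (hpq : p ≤ q) (hq : q ≤ N) :
    x p ≤ x q := by
  induction q, hpq using Nat.le_induction with
  | base => exact le_rfl
  | succ q hpq ih => exact (ih (by omega)).trans (h.lt_succ q (by omega)).le

lemma mem_Icc (h : IsFinePartition η N x) {p : ℕ} (hp : p ≤ N) : x p ∈ Set.Icc (0 : ℝ) 1 :=
  ⟨h.zero ▸ h.le_of_le (Nat.zero_le p) hp, h.last ▸ h.le_of_le hp le_rfl⟩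

end IsFinePartition

/-- The Riemann sum `∑_{q=1}^p (x_q - x_{q-1}) / s(x_q)` of the travel time. -/
def travelSum (s : ℝ → ℝ) (x : ℕ → ℝ) (p : ℕ) : ℝ :=
  ∑ q ∈ Finset.Icc 1 p, (x q - x (q - 1)) / s (x q)

/-- The pair of amplitudes of even and odd number of reflections, with phases factored out. -/
def amplitude (c : ℂ) (r t : ℕ → ℝ) : ℕ → ℂ × ℂ
  | 0 => (1, 0)
  | p + 1 =>
    ((amplitude c r t p).1 + r (p + 1) * Complex.exp (-c * t (p + 1)) * (amplitude c r t p).2,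
      (amplitude c r t p).2 + r (p + 1) * Complex.exp (c * t (p + 1)) * (amplitude c r t p).1)

section Convergence

variable {s d : ℝ → ℝ}

lemma travelSum_succ (x : ℕ → ℝ) (p : ℕ) :
    travelSum s x (p + 1) = travelSum s x p + (x (p + 1) - x p) / s (x (p + 1)) := by
  simp [travelSum, Finset.sum_Icc_succ_top]

lemma exists_travelSum_error (hs : Continuous s) (hpos : ∀ x, 0 < s x) {δ : ℝ} (hδ : 0 < δ) :
    ∃ η > 0, ∀ N x, IsFinePartition η N x → ∀ p ≤ N,
      |travelSum s x p - travelTime s (x p)| ≤ δ * x p := by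
  have huc := (isCompact_Icc (a := (0 : ℝ)) (b := 1)).uniformContinuousOn_of_continuous
    (continuous_one_div hs hpos).continuousOn
  obtain ⟨η, hη, huc⟩ := Metric.uniformContinuousOn_iff.mp huc δ hδ
  refine ⟨η, hη, fun N x hx p => ?_⟩
  induction p with
  | zero => simp [travelSum, travelTime, hx.zero]
  | succ p ih =>
    intro hp
    have hlt := hx.lt_succ p hp
    have hint := (continuous_one_div hs hpos).intervalIntegrable (μ := volume) (x p) (x (p + 1))
    have h1 : travelSum s x (p + 1) - travelTime s (x (p + 1)) =
        (travelSum s x p - travelTime s (x p)) +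
          ∫ y in x p..x (p + 1), (1 / s (x (p + 1)) - 1 / s y) := by
      rw [intervalIntegral.integral_sub (by simp) hint, intervalIntegral.integral_const,
        ← travelTime_sub hs hpos, travelSum_succ, smul_eq_mul]
      ring
    have h2 : ‖∫ y in x p..x (p + 1), (1 / s (x (p + 1)) - 1 / s y)‖ ≤
        δ * |x (p + 1) - x p| := by
      refine intervalIntegral.norm_integral_le_of_norm_le_const fun y hy => ?_
      rw [Set.uIoc_of_le hlt.le] at hy
      have hy' : y ∈ Set.Icc (0 : ℝ) 1 :=
        ⟨(hx.mem_Icc (by omega)).1.trans hy.1.le, hy.2.trans (hx.mem_Icc hp).2⟩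
      have := huc (x (p + 1)) (hx.mem_Icc hp) y hy' (by
        rw [Real.dist_eq, abs_of_nonneg (by linarith [hy.2])]
        linarith [hx.step_lt p hp, hy.1])
      rw [dist_eq_norm] at this
      exact this.le
    rw [abs_of_pos (by linarith), Real.norm_eq_abs] at h2
    rw [h1]
    refine (abs_add_le _ _).trans ?_
    linarith [ih (by omega)]

lemma exists_travelTime_bound (hs : Continuous s) (hpos : ∀ x, 0 < s x) :
    ∃ M > 0, (∀ y ∈ Set.Icc (0 : ℝ) 1, 1 / s y ≤ M) ∧
      ∀ a b, 0 ≤ a → a ≤ b → b ≤ 1 →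
        0 ≤ travelTime s b - travelTime s a ∧
          travelTime s b - travelTime s a ≤ M * (b - a) := by
  obtain ⟨M, hM⟩ := isCompact_Icc.exists_bound_of_continuousOn (s := Set.Icc (0 : ℝ) 1)
    (continuous_one_div hs hpos).continuousOn
  have hM' : ∀ y ∈ Set.Icc (0 : ℝ) 1, 1 / s y ≤ M := fun y hy => (le_abs_self _).trans (hM y hy)
  refine ⟨M, (one_div_pos.mpr (hpos 0)).trans_le (hM' 0 (by simp)), hM',
    fun a b ha hab hb => ?_⟩
  rw [travelTime_sub hs hpos]
  refine ⟨intervalIntegral.integral_nonneg hab fun y _ => (one_div_pos.mpr (hpos y)).le, ?_⟩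
  have := intervalIntegral.integral_mono_on (μ := volume) hab
    ((continuous_one_div hs hpos).intervalIntegrable _ _)
    (g := fun _ => M) intervalIntegrable_const
    fun y hy => hM' y ⟨ha.trans hy.1, hy.2.trans hb⟩
  simpa [mul_comm] using this

lemma travelSum_mem_Icc (hpos : ∀ x, 0 < s x) {M η : ℝ}
    (hM : ∀ y ∈ Set.Icc (0 : ℝ) 1, 1 / s y ≤ M) {N : ℕ} {x : ℕ → ℝ}
    (hx : IsFinePartition η N x) {p : ℕ} (hp : p ≤ N) : travelSum s x p ∈ Set.Icc 0 M := by
  have hM0 : 0 ≤ M := (one_div_pos.mpr (hpos 0)).le.trans (hM 0 (by simp))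
  have h : 0 ≤ travelSum s x p ∧ travelSum s x p ≤ M * x p := by
    induction p with
    | zero => simp [travelSum, hx.zero]
    | succ p ih =>
      obtain ⟨h0, h1⟩ := ih (by omega)
      have hlt := hx.lt_succ p hp
      have h2 : (x (p + 1) - x p) / s (x (p + 1)) ≤ M * (x (p + 1) - x p) := by
        rw [div_eq_mul_one_div, mul_comm]
        exact mul_le_mul_of_nonneg_right (hM _ (hx.mem_Icc hp)) (by linarith)
      have h3 : 0 ≤ (x (p + 1) - x p) / s (x (p + 1)) :=
        div_nonneg (by linarith) (hpos _).le
      rw [travelSum_succ]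
      constructor <;> linarith
  exact ⟨h.1, h.2.trans (mul_le_of_le_one_right hM0 (hx.mem_Icc hp).2)⟩

/-- The discrete reflection coefficients `r_p = (s_{p+1} - s_p)/(s_{p+1} + s_p)`, with the
increment of `s` rewritten by the mean value theorem. -/
def IsReflection (s d : ℝ → ℝ) (N : ℕ) (x r : ℕ → ℝ) : Prop :=
  ∀ p, 1 ≤ p → p < N → ∃ ξ ∈ Set.Icc (x p) (x (p + 1)),
    r p = (x (p + 1) - x p) * (d ξ / (s (x p) + s (x (p + 1))))

lemma exists_amplitude_error (hs : Continuous s) (hpos : ∀ x, 0 < s x) (hd : Continuous d)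
    (c : ℂ) {ε : ℝ} (hε : 0 < ε) :
    ∃ η > 0, ∀ N x r, IsFinePartition η N x → IsReflection s d N x r →
      ‖(amplitude c r (travelSum s x) (N - 1)).1 - evenSum (kernelSeq s d c) 1‖ +
        ‖(amplitude c r (travelSum s x) (N - 1)).2 - oddSum (kernelSeq s d c) 1‖ ≤ ε := by
  set f := kernelSeq s d c with hf_def
  set U := evenSum f
  set V := oddSum f
  have hf : ∀ n, Continuous (f n) := continuous_kernelSeq hs hpos hd c
  obtain ⟨B, hB⟩ := exists_bound_kernelSeq hs hpos hd c
  have hper : ∀ n, f (n + 2) = f n := kernelSeq_add_two c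
  have hUc : ContinuousOn U (Set.Icc 0 1) :=
    continuousOn_tsum_iterInt hf hB (φ := fun m => 2 * m) (fun a b h => by simpa using h)
  have hVc : ContinuousOn V (Set.Icc 0 1) :=
    continuousOn_tsum_iterInt hf hB (φ := fun m => 2 * m + 1) (fun a b h => by simpa using h)
  have hU : ∀ y ∈ Set.Icc (0 : ℝ) 1, U y = 1 + ∫ z in (0 : ℝ)..y, f 1 z * V z :=
    fun y hy => evenSum_eq_integral hf hB hper hy
  have hV : ∀ y ∈ Set.Icc (0 : ℝ) 1, V y = ∫ z in (0 : ℝ)..y, f 0 z * U z :=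
    fun y hy => oddSum_eq_integral hf hB hper hy
  have hint : ∀ n W, ContinuousOn W (Set.Icc 0 1) → ∀ a ∈ Set.Icc (0 : ℝ) 1,
      ∀ b ∈ Set.Icc (0 : ℝ) 1, IntervalIntegrable (fun z => f n z * W z) volume a b :=
    fun n W hW a ha b hb => (((hf n).continuousOn.mul hW).mono
      (Set.uIcc_subset_Icc ha hb)).intervalIntegrable
  have hU' : ∀ a ∈ Set.Icc (0 : ℝ) 1, ∀ b ∈ Set.Icc (0 : ℝ) 1,
      U b = U a + ∫ z in a..b, f 1 z * V z := fun a ha b hb => by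
    rw [hU a ha, hU b hb, add_assoc, intervalIntegral.integral_add_adjacent_intervals
      (hint 1 V hVc 0 (by simp) a ha) (hint 1 V hVc a ha b hb)]
  have hV' : ∀ a ∈ Set.Icc (0 : ℝ) 1, ∀ b ∈ Set.Icc (0 : ℝ) 1,
      V b = V a + ∫ z in a..b, f 0 z * U z := fun a ha b hb => by
    rw [hV a ha, hV b hb, intervalIntegral.integral_add_adjacent_intervals
      (hint 0 U hUc 0 (by simp) a ha) (hint 0 U hUc a ha b hb)]
  obtain ⟨M, hM0, hM, hτ⟩ := exists_travelTime_bound hs hpos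
  have hτM : ∀ y ∈ Set.Icc (0 : ℝ) 1, travelTime s y ∈ Set.Icc 0 M := fun y hy => by
    have h := hτ 0 y le_rfl hy.1 hy.2
    have h0 : travelTime s 0 = 0 := by simp [travelTime]
    rw [h0, sub_zero, sub_zero] at h
    exact ⟨h.1, h.2.trans (mul_le_of_le_one_right hM0.le hy.2)⟩
  obtain ⟨C₀, hC₀, hC₀'⟩ := exists_bound_coupling hs hpos hd c M
  obtain ⟨C₁, hC₁, hC₁'⟩ := exists_bound_coupling hs hpos hd (-c) M
  set C := max C₀ C₁
  have hC : 0 ≤ C := hC₀.trans (le_max_left _ _)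
  set ε' := ε / Real.exp (C + 1) with hε'_def
  have hε' : 0 < ε' := by positivity
  obtain ⟨δ₀, hδ₀, hstep₀⟩ := exists_step_error hs hpos hd c hτM hUc (half_pos hε')
  obtain ⟨δ₁, hδ₁, hstep₁⟩ := exists_step_error hs hpos hd (-c) hτM hVc (half_pos hε')
  set δ := min δ₀ δ₁
  have hδ : 0 < δ := lt_min hδ₀ hδ₁
  obtain ⟨η₁, hη₁, hsum⟩ := exists_travelSum_error hs hpos (half_pos hδ)
  obtain ⟨ηU, hηU, hU0⟩ := Metric.continuousOn_iff.mp hUc 0 (by simp) _ (half_pos hε')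
  obtain ⟨ηV, hηV, hV0⟩ := Metric.continuousOn_iff.mp hVc 0 (by simp) _ (half_pos hε')
  refine ⟨min (min δ η₁) (min (δ / (2 * M)) (min ηU ηV)), by positivity, fun N x r hx hr => ?_⟩
  set t := travelSum s x
  have hη : ∀ p < N, x (p + 1) - x p < δ ∧ x (p + 1) - x p < η₁ ∧
      x (p + 1) - x p < δ / (2 * M) ∧ x (p + 1) - x p < ηU ∧ x (p + 1) - x p < ηV :=
    fun p hp => by
      have := hx.step_lt p hp
      simp only [lt_min_iff] at this
      tauto
  have hx₁ : IsFinePartition η₁ N x := ⟨hx.1, hx.2, hx.3, hx.4, fun p hp => (hη p hp).2.1⟩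
  have htM : ∀ p ≤ N, t p ∈ Set.Icc 0 M := fun p hp => travelSum_mem_Icc hpos hM hx hp
  have htτ : ∀ p < N, ∀ y ∈ Set.Icc (x p) (x (p + 1)), |t p - travelTime s y| < δ := by
    intro p hp y hy
    have h1 : |t p - travelTime s (x p)| ≤ δ / 2 := by
      refine (hsum N x hx₁ p hp.le).trans ?_
      exact mul_le_of_le_one_right (by positivity) (hx.mem_Icc hp.le).2
    have h2 := hτ (x p) y (hx.mem_Icc hp.le).1 hy.1 (hy.2.trans (hx.mem_Icc hp).2)
    have h3 : M * (y - x p) < δ / 2 := by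
      have : y - x p < δ / (2 * M) := by linarith [hy.2, (hη p hp).2.2.1]
      calc M * (y - x p) < M * (δ / (2 * M)) := by gcongr
        _ = δ / 2 := by field_simp
    rw [abs_le] at h1
    rw [abs_lt]
    constructor <;> linarith
  have hU00 : U 0 = 1 := by rw [hU 0 (by simp)]; simp
  have hV00 : V 0 = 0 := by rw [hV 0 (by simp)]; simp
  have hmain := le_mul_exp_of_step_le (N := N) (x := x) (C := C) (ε := ε')
    (e := fun p => ‖(amplitude c r t (p - 1)).1 - U (x p)‖ +
      ‖(amplitude c r t (p - 1)).2 - V (x p)‖) hC hε'.le (hx.mem_Icc hx.one_le).1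
    (fun p _ hp => (hx.lt_succ p hp).le) ?_ ?_ hx.one_le le_rfl
  · have := hmain.2
    simp only [hx.last, mul_one] at this
    refine this.trans (le_of_eq ?_)
    rw [hε'_def, div_mul_cancel₀ _ (Real.exp_pos _).ne']
  · have h0 := hη 0 hx.one_le
    have hx1 := hx.mem_Icc hx.one_le
    rw [zero_add, hx.zero, sub_zero] at h0
    have hd1 : ∀ {ρ}, x 1 < ρ → dist (x 1) 0 < ρ := fun h => by
      rwa [Real.dist_eq, sub_zero, abs_of_nonneg hx1.1]
    have h1 := hU0 (x 1) hx1 (hd1 h0.2.2.2.1)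
    have h2 := hV0 (x 1) hx1 (hd1 h0.2.2.2.2)
    rw [dist_comm, dist_eq_norm, hU00] at h1
    rw [dist_comm, dist_eq_norm, hV00] at h2
    simp only [amplitude, Nat.sub_self]
    linarith
  · intro p hp1 hpN
    obtain ⟨ξ, hξ, hrp⟩ := hr p hp1 hpN
    obtain ⟨p, rfl⟩ : ∃ q, p = q + 1 := ⟨p - 1, by omega⟩
    set a := x (p + 1)
    set b := x (p + 1 + 1)
    have ha := hx.mem_Icc hpN.le
    have hb := hx.mem_Icc (p := p + 1 + 1) hpN
    have hab : a ≤ b := (hx.lt_succ _ hpN).le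
    have hξ' : ξ ∈ Set.Icc (0 : ℝ) 1 := ⟨ha.1.trans hξ.1, hξ.2.trans hb.2⟩
    have hr0 : (r (p + 1) : ℂ) * Complex.exp (c * t (p + 1)) =
        ((b - a : ℝ) : ℂ) * coupling s d c ξ a b (t (p + 1)) := by
      rw [hrp, coupling]; push_cast; ring
    have hr1 : (r (p + 1) : ℂ) * Complex.exp (-c * t (p + 1)) =
        ((b - a : ℝ) : ℂ) * coupling s d (-c) ξ a b (t (p + 1)) := by
      rw [hrp, coupling]; push_cast; ring
    have hδp := (hη _ hpN).1
    have hE0 := hstep₀ a b ξ (t (p + 1)) ha.1 hab hb.2 (hδp.trans_le (min_le_left _ _)) hξ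
      (htM _ hpN.le) (fun y hy => (htτ _ hpN y hy).trans_le (min_le_left _ _))
    have hE1 := hstep₁ a b ξ (t (p + 1)) ha.1 hab hb.2 (hδp.trans_le (min_le_right _ _)) hξ
      (htM _ hpN.le) (fun y hy => (htτ _ hpN y hy).trans_le (min_le_right _ _))
    have hB0 : ‖((b - a : ℝ) : ℂ) * coupling s d c ξ a b (t (p + 1))‖ ≤ C * (b - a) := by
      rw [norm_mul, Complex.norm_real, Real.norm_of_nonneg (by linarith), mul_comm]
      gcongr
      exact (hC₀' _ hξ' _ ha _ hb _ (htM _ hpN.le)).trans (le_max_left _ _)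
    have hB1 : ‖((b - a : ℝ) : ℂ) * coupling s d (-c) ξ a b (t (p + 1))‖ ≤ C * (b - a) := by
      rw [norm_mul, Complex.norm_real, Real.norm_of_nonneg (by linarith), mul_comm]
      gcongr
      exact (hC₁' _ hξ' _ ha _ hb _ (htM _ hpN.le)).trans (le_max_right _ _)
    have hf0 : ∀ z, coupling s d c z z z (travelTime s z) = f 0 z := fun z => by
      simp [hf_def, kernelSeq]
    have hf1 : ∀ z, coupling s d (-c) z z z (travelTime s z) = f 1 z := fun z => by
      simp [hf_def, kernelSeq]
    simp only [hf0] at hE0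
    simp only [hf1] at hE1
    simp only [Nat.add_sub_cancel, amplitude]
    rw [hr0, hr1, hU' a ha b hb, hV' a ha b hb]
    set u := (amplitude c r t p).1
    set v := (amplitude c r t p).2
    set κ₀ := ((b - a : ℝ) : ℂ) * coupling s d c ξ a b (t (p + 1))
    set κ₁ := ((b - a : ℝ) : ℂ) * coupling s d (-c) ξ a b (t (p + 1))
    set I₀ := ∫ z in a..b, f 0 z * U z
    set I₁ := ∫ z in a..b, f 1 z * V z
    have key : ∀ u u' v v' κ I : ℂ, ‖κ‖ ≤ C * (b - a) → ‖κ * v' - I‖ ≤ ε' / 2 * (b - a) →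
        ‖u + κ * v - (u' + I)‖ ≤
          ‖u - u'‖ + C * (b - a) * ‖v - v'‖ + ε' / 2 * (b - a) := by
      intro u u' v v' κ I h1 h2
      have : u + κ * v - (u' + I) = (u - u') + κ * (v - v') + (κ * v' - I) := by ring
      rw [this]
      refine (norm_add₃_le).trans ?_
      rw [norm_mul]
      gcongr
    have h1 := key u (U a) v (V a) κ₁ I₁ hB1 hE1
    have h2 := key v (V a) u (U a) κ₀ I₀ hB0 hE0
    linarith

end Convergence

/-- The part of the exponential analogue of `Dsum` with `ℓ_N = b`, for reflection
coefficients `r` and travel times `w`. -/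
def pathSum (c : ℂ) (r w : ℕ → ℝ) (N : ℕ) (b : Bool) : ℂ :=
  ∑ ℓ : Fin N → Bool,
    if entry N ℓ 1 = false ∧ entry N ℓ N = b then
      ((∏ p ∈ Finset.Ico 1 N, if entry N ℓ p = entry N ℓ (p + 1) then 1 else r p : ℝ) : ℂ) *
        Complex.exp (c * ((∑ p ∈ Finset.Icc 1 N,
          (if entry N ℓ p then (-1 : ℝ) else 1) * w p : ℝ) : ℂ))
    else 0

section PathSum

variable (c : ℂ) (r w : ℕ → ℝ)

lemma entry_snoc_of_le {N : ℕ} (ℓ : Fin N → Bool) (b : Bool) {p : ℕ} (hp : 1 ≤ p) (hpN : p ≤ N) :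
    entry (N + 1) (Fin.snoc (α := fun _ => Bool) ℓ b) p = entry N ℓ p := by
  have h : p - 1 < N := by omega
  rw [entry, dif_pos ⟨hp, by omega⟩, entry, dif_pos ⟨hp, hpN⟩]
  exact Fin.snoc_castSucc (α := fun _ => Bool) b ℓ ⟨p - 1, h⟩

lemma entry_snoc_last {N : ℕ} (ℓ : Fin N → Bool) (b : Bool) :
    entry (N + 1) (Fin.snoc (α := fun _ => Bool) ℓ b) (N + 1) = b := by
  rw [entry, dif_pos ⟨by omega, le_rfl⟩]
  exact Fin.snoc_last (α := fun _ => Bool) b ℓ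

lemma pathSum_one (b : Bool) :
    pathSum c r w 1 b = if b then 0 else Complex.exp (c * w 1) := by
  unfold pathSum
  rw [Fintype.sum_equiv (Equiv.funUnique (Fin 1) Bool) _ (fun a => if a = false ∧ a = b then
    Complex.exp (c * (((if a then (-1 : ℝ) else 1) * w 1 : ℝ) : ℂ)) else 0)]
  · cases b <;> simp
  · intro ℓ
    simp [entry]

lemma pathSum_succ {N : ℕ} (hN : 1 ≤ N) (b : Bool) :
    pathSum c r w (N + 1) b =
      Complex.exp (c * (((if b then (-1 : ℝ) else 1) * w (N + 1) : ℝ) : ℂ)) *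
        (pathSum c r w N b + r N * pathSum c r w N (!b)) := by
  have hterm : ∀ (a : Bool) (ℓ : Fin N → Bool),
      (if entry (N + 1) (Fin.snoc (α := fun _ => Bool) ℓ a) 1 = false ∧
        entry (N + 1) (Fin.snoc (α := fun _ => Bool) ℓ a) (N + 1) = b then
      ((∏ p ∈ Finset.Ico 1 (N + 1), if entry (N + 1) (Fin.snoc (α := fun _ => Bool) ℓ a) p =
          entry (N + 1) (Fin.snoc (α := fun _ => Bool) ℓ a) (p + 1) then 1 else r p : ℝ) : ℂ) *
        Complex.exp (c * ((∑ p ∈ Finset.Icc 1 (N + 1),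
          (if entry (N + 1) (Fin.snoc (α := fun _ => Bool) ℓ a) p then (-1 : ℝ) else 1) * w p :
            ℝ) : ℂ))
      else 0) =
      if a = b then
        Complex.exp (c * (((if b then (-1 : ℝ) else 1) * w (N + 1) : ℝ) : ℂ)) *
        ((if entry N ℓ 1 = false ∧ entry N ℓ N = b then
          ((∏ p ∈ Finset.Ico 1 N, if entry N ℓ p = entry N ℓ (p + 1) then 1 else r p : ℝ) : ℂ) *
          Complex.exp (c * ((∑ p ∈ Finset.Icc 1 N,
            (if entry N ℓ p then (-1 : ℝ) else 1) * w p : ℝ) : ℂ)) else 0) +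
        r N * (if entry N ℓ 1 = false ∧ entry N ℓ N = !b then
          ((∏ p ∈ Finset.Ico 1 N, if entry N ℓ p = entry N ℓ (p + 1) then 1 else r p : ℝ) : ℂ) *
          Complex.exp (c * ((∑ p ∈ Finset.Icc 1 N,
            (if entry N ℓ p then (-1 : ℝ) else 1) * w p : ℝ) : ℂ)) else 0))
      else 0 := by
    intro a ℓ
    have hprod : (∏ p ∈ Finset.Ico 1 N, if entry (N + 1) (Fin.snoc (α := fun _ => Bool) ℓ a) p =
          entry (N + 1) (Fin.snoc (α := fun _ => Bool) ℓ a) (p + 1) then 1 else r p) =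
        ∏ p ∈ Finset.Ico 1 N, if entry N ℓ p = entry N ℓ (p + 1) then 1 else r p :=
      Finset.prod_congr rfl fun p hp => by
        rw [Finset.mem_Ico] at hp
        rw [entry_snoc_of_le ℓ a hp.1 hp.2.le, entry_snoc_of_le ℓ a (by omega) hp.2]
    have hsum : (∑ p ∈ Finset.Icc 1 N,
          (if entry (N + 1) (Fin.snoc (α := fun _ => Bool) ℓ a) p then (-1 : ℝ) else 1) * w p) =
        ∑ p ∈ Finset.Icc 1 N, (if entry N ℓ p then (-1 : ℝ) else 1) * w p :=
      Finset.sum_congr rfl fun p hp => by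
        rw [Finset.mem_Icc] at hp
        rw [entry_snoc_of_le ℓ a hp.1 hp.2]
    rw [Finset.prod_Ico_succ_top hN, Finset.sum_Icc_succ_top (by omega), hprod, hsum,
      entry_snoc_of_le ℓ a le_rfl hN, entry_snoc_of_le ℓ a hN le_rfl, entry_snoc_last]
    generalize (∏ p ∈ Finset.Ico 1 N, if entry N ℓ p = entry N ℓ (p + 1) then 1 else r p) = P
    generalize (∑ p ∈ Finset.Icc 1 N, (if entry N ℓ p then (-1 : ℝ) else 1) * w p) = Q
    push_cast
    rw [mul_add, Complex.exp_add]
    cases entry N ℓ 1 <;> cases entry N ℓ N <;> cases a <;> cases b <;> simp <;> ring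
  rw [pathSum, ← (Fin.snocEquiv fun _ : Fin (N + 1) => Bool).sum_comp, Fintype.sum_prod_type]
  refine (Finset.sum_congr rfl fun a _ => Finset.sum_congr rfl fun ℓ _ => hterm a ℓ).trans ?_
  rw [Finset.sum_comm]
  simp only [Finset.sum_ite_eq', Finset.mem_univ, if_true]
  rw [← Finset.mul_sum, Finset.sum_add_distrib, ← Finset.mul_sum]
  rfl

lemma pathSum_eq_amplitude (N : ℕ) :
    pathSum c r w (N + 1) false = Complex.exp (c * ((∑ p ∈ Finset.Icc 1 (N + 1), w p : ℝ) : ℂ)) *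
        (amplitude (2 * c) r (fun p => ∑ q ∈ Finset.Icc 1 p, w q) N).1 ∧
      pathSum c r w (N + 1) true = Complex.exp (-c * ((∑ p ∈ Finset.Icc 1 (N + 1), w p : ℝ) : ℂ)) *
        (amplitude (2 * c) r (fun p => ∑ q ∈ Finset.Icc 1 p, w q) N).2 := by
  induction N with
  | zero => simp [pathSum_one, amplitude]
  | succ N ih =>
    obtain ⟨ih1, ih2⟩ := ih
    rw [pathSum_succ c r w (Nat.le_add_left 1 N), pathSum_succ c r w (Nat.le_add_left 1 N), Bool.not_false,
      Bool.not_true, ih1, ih2, Finset.sum_Icc_succ_top (b := N + 1) (by omega)]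
    simp only [amplitude]
    generalize (∑ p ∈ Finset.Icc 1 (N + 1), w p) = t
    have e1 : Complex.exp (-(2 * c) * t) = Complex.exp (-c * t) * Complex.exp (-c * t) := by
      rw [← Complex.exp_add]; ring_nf
    have e2 : Complex.exp (2 * c * t) = Complex.exp (c * t) * Complex.exp (c * t) := by
      rw [← Complex.exp_add]; ring_nf
    have e3 : Complex.exp (c * t) * Complex.exp (-c * t) = 1 := by
      rw [← Complex.exp_add]; simp
    rw [e1, e2]
    push_cast
    simp only [mul_add, Complex.exp_add, one_mul, neg_mul, mul_neg] at e3 ⊢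
    generalize Complex.exp (c * t) = X at *
    generalize Complex.exp (-(c * t)) = Y at *
    constructor
    · linear_combination (-r (N + 1) * Y * Complex.exp (c * w (N + 1 + 1)) *
        (amplitude (2 * c) r (fun p => ∑ q ∈ Finset.Icc 1 p, w q) N).2) * e3
    · linear_combination (-r (N + 1) * X * Complex.exp (-(c * w (N + 1 + 1))) *
        (amplitude (2 * c) r (fun p => ∑ q ∈ Finset.Icc 1 p, w q) N).1) * e3

end PathSum

lemma Dsum_eq_pathSum {σ : ℝ → ℝ} (k : ℂ) {N : ℕ} {x r w : ℕ → ℝ}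
    (hne : ∀ p ∈ Finset.Ico 1 N, σ (x (p + 1)) + σ (x p) ≠ 0)
    (hr : ∀ p ∈ Finset.Ico 1 N, r p = (σ (x (p + 1)) - σ (x p)) / (σ (x (p + 1)) + σ (x p)))
    (hw : ∀ p ∈ Finset.Icc 1 N, w p = (x p - x (p - 1)) / σ (x p)) :
    Dsum σ k N x =
      (∑ b, pathSum (-(k * Complex.I)) r w N b - ∑ b, pathSum (k * Complex.I) r w N b) *
        Complex.I / 2 := by
  unfold Dsum pathSum
  rw [Finset.sum_comm, Finset.sum_comm (s := (Finset.univ : Finset Bool)),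
    ← Finset.sum_sub_distrib, Finset.sum_mul, Finset.sum_div]
  refine Finset.sum_congr rfl fun ℓ _ => ?_
  have hprod : (∏ p ∈ Finset.Ico 1 N, (σ (x (p + 1)) +
      (if entry N ℓ p = entry N ℓ (p + 1) then σ (x p) else -σ (x p))) /
        (σ (x (p + 1)) + σ (x p))) =
      ∏ p ∈ Finset.Ico 1 N, if entry N ℓ p = entry N ℓ (p + 1) then 1 else r p :=
    Finset.prod_congr rfl fun p hp => by
      split_ifs
      · exact div_self (hne p hp)
      · rw [hr p hp, sub_eq_add_neg]
  have hsum : (∑ p ∈ Finset.Icc 1 N,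
      (if entry N ℓ p then (-1 : ℝ) else 1) * (x p - x (p - 1)) / σ (x p)) =
      ∑ p ∈ Finset.Icc 1 N, (if entry N ℓ p then (-1 : ℝ) else 1) * w p :=
    Finset.sum_congr rfl fun p hp => by rw [hw p hp, mul_div_assoc]
  rw [hprod, hsum]
  by_cases h : entry N ℓ 1 = false
  · simp only [h, true_and, if_true, Finset.sum_ite_eq, Finset.mem_univ, Complex.sin]
    ring_nf
  · simp [h]

lemma isCompact_simplex {b : ℝ} (hb : 0 ≤ b) (n : ℕ) : IsCompact (simplex 0 b n) := by
  refine (isCompact_Icc (a := (fun _ => 0 : Fin n → ℝ)) (b := fun _ => b)).of_isClosed_subset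
    ?_ fun y hy => ⟨fun i => (hy.2 i).1, fun i => (hy.2 i).2⟩
  have : simplex 0 b n = Prod.mk b ⁻¹'
      {q : ℝ × (Fin n → ℝ) | q.1 ∈ Set.Icc 0 b ∧ q.2 ∈ simplex 0 q.1 n} := by
    ext z; simp [hb]
  exact this ▸ (isClosed_pairs b n).preimage (by fun_prop)

lemma sum_alternating_sub (T : ℕ → ℝ) (n : ℕ) :
    ∑ p ∈ Finset.range (n + 1), (-1 : ℝ) ^ p * (T (p + 1) - T p) =
      (-1) ^ n * T (n + 1) - T 0 + 2 * ∑ p ∈ Finset.range n, (-1 : ℝ) ^ p * T (p + 1) := by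
  induction n with
  | zero => simp
  | succ n ih =>
    rw [Finset.sum_range_succ, ih, Finset.sum_range_succ _ n]
    ring

section DeltaSeries

variable {σ s d : ℝ → ℝ}

lemma phase_eq (hs : Continuous s) (hpos : ∀ x, 0 < s x)
    (hσs : ∀ x ∈ Set.Icc (0 : ℝ) 1, σ x = s x) {n : ℕ} {y : Fin n → ℝ} (hy : y ∈ simplex 0 1 n) :
    phase σ 0 1 n y =
      (-1) ^ n * travelTime s 1 + 2 * ∑ i : Fin n, (-1 : ℝ) ^ (i : ℕ) * travelTime s (y i) := by
  have hmem : ∀ p, nodes 0 1 n y p ∈ Set.Icc (0 : ℝ) 1 := fun p => by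
    unfold nodes
    split_ifs
    · exact hy.2 _
    · simp
    · simp
  have h1 : phase σ 0 1 n y = ∑ p ∈ Finset.range (n + 1), (-1 : ℝ) ^ p *
      (travelTime s (nodes 0 1 n y (p + 1)) - travelTime s (nodes 0 1 n y p)) := by
    refine Finset.sum_congr rfl fun p _ => ?_
    rw [travelTime_sub hs hpos]
    congr 1
    refine intervalIntegral.integral_congr fun ξ hξ => ?_
    simp only [hσs ξ (Set.uIcc_subset_Icc (hmem p) (hmem (p + 1)) hξ)]
  rw [h1, sum_alternating_sub (fun p => travelTime s (nodes 0 1 n y p)), Finset.sum_range]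
  have h0 : nodes 0 1 n y 0 = 0 := by simp [nodes]
  have hlast : nodes 0 1 n y (n + 1) = 1 := by simp [nodes]
  have hi : ∀ i : Fin n, nodes 0 1 n y (i + 1) = y i := fun i => by
    have : (i : ℕ) + 1 ≤ n := i.2
    simp [nodes, this]
  simp only [h0, hlast, hi]
  simp [travelTime]

lemma prod_kernelSeq (c : ℂ) {n : ℕ} (y : Fin n → ℝ) :
    ∏ i : Fin n, kernelSeq s d (2 * c) i (y i) =
      ((∏ i, d (y i) / (s (y i) + s (y i)) : ℝ) : ℂ) *
        Complex.exp (c * ((2 * ∑ i : Fin n, (-1 : ℝ) ^ (i : ℕ) * travelTime s (y i) : ℝ) : ℂ)) := by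
  simp only [kernelSeq, coupling, Finset.prod_mul_distrib, ← Complex.exp_sum]
  push_cast
  congr 2
  rw [Finset.mul_sum, Finset.mul_sum]
  exact Finset.sum_congr rfl fun i _ => by ring

lemma S_eq_iterInt (hs : Continuous s) (hpos : ∀ x, 0 < s x) (hd : Continuous d)
    (hσs : ∀ x ∈ Set.Icc (0 : ℝ) 1, σ x = s x) (hσd : ∀ x ∈ Set.Ioo (0 : ℝ) 1, deriv σ x = d x)
    (n : ℕ) (k : ℂ) :
    S σ 0 1 n k =
      (Complex.exp (-(k * Complex.I) * ((-1) ^ n * travelTime s 1)) *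
          iterInt (kernelSeq s d (2 * -(k * Complex.I))) n 1 -
        Complex.exp (k * Complex.I * ((-1) ^ n * travelTime s 1)) *
          iterInt (kernelSeq s d (2 * (k * Complex.I))) n 1) * Complex.I / 2 := by
  have hk := fun c : ℂ => continuous_kernelSeq hs hpos hd (2 * c)
  have hcomp := isCompact_simplex (zero_le_one (α := ℝ)) n
  have hint : ∀ c : ℂ, IntegrableOn
      (fun y : Fin n → ℝ => ∏ i : Fin n, kernelSeq s d (2 * c) i (y i)) (simplex 0 1 n) :=
    fun c => (continuous_finsetProd Finset.univ fun (i : Fin n) _ =>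
      (hk c (i : ℕ)).comp (continuous_apply i)).continuousOn.integrableOn_compact hcomp
  have hne : ∀ᵐ y : Fin n → ℝ, ∀ i, y i ≠ 0 ∧ y i ≠ 1 := ae_all_iff.mpr fun i =>
    (Measure.ae_eval_ne (fun _ => volume) i 0).and (Measure.ae_eval_ne (fun _ => volume) i 1)
  rw [← setIntegral_simplex_prod (hk _) n zero_le_one, ← setIntegral_simplex_prod (hk _) n
    zero_le_one, ← integral_const_mul, ← integral_const_mul,
    ← integral_sub ((hint _).const_mul _) ((hint _).const_mul _), mul_div_assoc,
    ← integral_mul_const, S, ← integral_const_mul]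
  refine setIntegral_congr_ae hcomp.measurableSet ?_
  filter_upwards [hne] with y hne hy
  have hprod : ((∏ p, deriv σ (y p) / σ (y p) : ℝ) : ℂ) =
      2 ^ n * ((∏ i, d (y i) / (s (y i) + s (y i)) : ℝ) : ℂ) := by
    have : (2 : ℂ) ^ n = ((∏ _i : Fin n, (2 : ℝ) : ℝ) : ℂ) := by simp
    rw [this, ← Complex.ofReal_mul, ← Finset.prod_mul_distrib]
    congr 1
    refine Finset.prod_congr rfl fun i _ => ?_
    have hyi := hy.2 i
    rw [hσd _ ⟨hyi.1.lt_of_ne' (hne i).1, hyi.2.lt_of_ne (hne i).2⟩, hσs _ hyi]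
    have := (hpos (y i)).ne'
    field_simp
    norm_num
  rw [Sintegrand, hprod, phase_eq hs hpos hσs hy, prod_kernelSeq, prod_kernelSeq, Complex.sin]
  have h2 : ((2 : ℂ) ^ n)⁻¹ * 2 ^ n = 1 := inv_mul_cancel₀ (pow_ne_zero n two_ne_zero)
  generalize ((∏ i, d (y i) / (s (y i) + s (y i)) : ℝ) : ℂ) = P
  generalize 2 * ∑ i : Fin n, (-1 : ℝ) ^ (i : ℕ) * travelTime s (y i) = Q
  rw [← mul_assoc, ← mul_assoc, h2, one_mul]
  push_cast
  rw [mul_left_comm _ P, mul_left_comm _ P, ← Complex.exp_add, ← Complex.exp_add]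
  ring_nf

/-- The limit of the exponential path sums. -/
def expLimit (s d : ℝ → ℝ) (c : ℂ) : ℂ :=
  Complex.exp (c * travelTime s 1) * evenSum (kernelSeq s d (2 * c)) 1 +
    Complex.exp (-c * travelTime s 1) * oddSum (kernelSeq s d (2 * c)) 1

lemma hasSum_exp_mul_iterInt (hs : Continuous s) (hpos : ∀ x, 0 < s x) (hd : Continuous d)
    (c : ℂ) :
    HasSum (fun n => Complex.exp (c * ((-1) ^ n * travelTime s 1)) *
      iterInt (kernelSeq s d (2 * c)) n 1) (expLimit s d c) := by
  obtain ⟨B, hB⟩ := exists_bound_kernelSeq hs hpos hd (2 * c)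
  refine HasSum.even_add_odd ?_ ?_
  · simp only [even_two, Even.mul_right, Even.neg_pow, one_pow, one_mul]
    exact (summable_iterInt_comp hB (φ := fun m => 2 * m) (fun a b h => by simpa using h)
      (by simp)).hasSum.mul_left _
  · have : ∀ m : ℕ, c * ((-1) ^ (2 * m + 1) * travelTime s 1) = -c * travelTime s 1 :=
      fun m => by simp [pow_succ]
    simp only [this]
    exact (summable_iterInt_comp hB (φ := fun m => 2 * m + 1) (fun a b h => by simpa using h)
      (by simp)).hasSum.mul_left _

lemma Δfun_eq (hs : Continuous s) (hpos : ∀ x, 0 < s x) (hd : Continuous d)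
    (hσs : ∀ x ∈ Set.Icc (0 : ℝ) 1, σ x = s x) (hσd : ∀ x ∈ Set.Ioo (0 : ℝ) 1, deriv σ x = d x)
    (k : ℂ) :
    Δfun σ k =
      (expLimit s d (-(k * Complex.I)) - expLimit s d (k * Complex.I)) * Complex.I / 2 := by
  simp only [Δfun, S_eq_iterInt hs hpos hd hσs hσd]
  exact ((((hasSum_exp_mul_iterInt hs hpos hd _).sub
    (hasSum_exp_mul_iterInt hs hpos hd _)).mul_right _).div_const _).tsum_eq

lemma tendsto_pathSum (hs : Continuous s) (hpos : ∀ x, 0 < s x) (hd : Continuous d) (c : ℂ)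
    {N : ℕ → ℕ} {x r : ℕ → ℕ → ℝ}
    (hx : ∀ η > 0, ∀ᶠ j in atTop, IsFinePartition η (N j) (x j))
    (hr : ∀ j, IsReflection s d (N j) (x j) (r j)) :
    Tendsto (fun j => ∑ b, pathSum c (r j) (fun p => (x j p - x j (p - 1)) / s (x j p)) (N j) b)
      atTop (nhds (expLimit s d c)) := by
  have ht : Tendsto (fun j => travelSum s (x j) (N j)) atTop (nhds (travelTime s 1)) := by
    refine Metric.tendsto_nhds.mpr fun ε hε => ?_
    obtain ⟨η, hη, h⟩ := exists_travelSum_error hs hpos (half_pos hε)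
    filter_upwards [hx η hη] with j hj
    have := h _ _ hj _ le_rfl
    rw [hj.last, mul_one] at this
    rw [Real.dist_eq]
    linarith
  have hamp : ∀ ε > 0, ∀ᶠ j in atTop,
      ‖(amplitude (2 * c) (r j) (travelSum s (x j)) (N j - 1)).1 -
          evenSum (kernelSeq s d (2 * c)) 1‖ +
        ‖(amplitude (2 * c) (r j) (travelSum s (x j)) (N j - 1)).2 -
          oddSum (kernelSeq s d (2 * c)) 1‖ < ε := fun ε hε => by
    obtain ⟨η, hη, h⟩ := exists_amplitude_error hs hpos hd (2 * c) (half_pos hε)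
    filter_upwards [hx η hη] with j hj
    linarith [h _ _ _ hj (hr j)]
  have h1 : Tendsto (fun j => (amplitude (2 * c) (r j) (travelSum s (x j)) (N j - 1)).1) atTop
      (nhds (evenSum (kernelSeq s d (2 * c)) 1)) :=
    Metric.tendsto_nhds.mpr fun ε hε => (hamp ε hε).mono fun j hj => by
      rw [dist_eq_norm]; exact (le_add_of_nonneg_right (norm_nonneg _)).trans_lt hj
  have h2 : Tendsto (fun j => (amplitude (2 * c) (r j) (travelSum s (x j)) (N j - 1)).2) atTop
      (nhds (oddSum (kernelSeq s d (2 * c)) 1)) :=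
    Metric.tendsto_nhds.mpr fun ε hε => (hamp ε hε).mono fun j hj => by
      rw [dist_eq_norm]; exact (le_add_of_nonneg_left (norm_nonneg _)).trans_lt hj
  have hexp : ∀ c : ℂ, Tendsto (fun j => Complex.exp (c * (travelSum s (x j) (N j) : ℝ))) atTop
      (nhds (Complex.exp (c * travelTime s 1))) := fun c =>
    ((by fun_prop : Continuous fun t : ℝ => Complex.exp (c * t)).tendsto _).comp ht
  refine (((hexp c).mul h1).add ((hexp (-c)).mul h2)).congr' ?_
  filter_upwards [hx 1 one_pos] with j hj
  obtain ⟨n, hn⟩ : ∃ n, N j = n + 1 := ⟨N j - 1, by have := hj.one_le; omega⟩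
  obtain ⟨e1, e2⟩ := pathSum_eq_amplitude c (r j)
    (fun p => (x j p - x j (p - 1)) / s (x j p)) n
  rw [hn, Fintype.sum_bool, e1, e2, add_comm]
  rfl

end DeltaSeries

/-- along any sequence of partitions of `[0,1]` whose mesh tends to `0`,
the discrete determinants `D_N(k)` converge to `Δ(k) = ∑ₙ S_n^{(0,1)}(k)`. -/
theorem stmt_10 (σ : ℝ → ℝ)
    (hσ : ContDiffOn ℝ 2 σ (Set.Icc 0 1))
    (hσpos : ∀ x ∈ Set.Icc (0 : ℝ) 1, 0 < σ x)
    (k : ℂ)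
    (N : ℕ → ℕ) (x : ℕ → ℕ → ℝ)
    (hN : ∀ j, 1 ≤ N j)
    (hx0 : ∀ j, x j 0 = 0) (hxN : ∀ j, x j (N j) = 1)
    (hmono : ∀ j, ∀ p < N j, x j p < x j (p + 1))
    (hmesh : Tendsto (fun j => (Finset.range (N j)).sup'
        (Finset.nonempty_range_iff.mpr (Nat.one_le_iff_ne_zero.mp (hN j)))
        (fun p => x j (p + 1) - x j p)) atTop (nhds 0)) :
    Tendsto (fun j => Dsum σ k (N j) (x j)) atTop (nhds (Δfun σ k)) := by
  set s : ℝ → ℝ := Set.IccExtend zero_le_one ((Set.Icc (0 : ℝ) 1).domRestrict σ) with hs_def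
  set d : ℝ → ℝ := Set.IccExtend zero_le_one
    ((Set.Icc (0 : ℝ) 1).domRestrict (derivWithin σ (Set.Icc 0 1))) with hd_def
  have hs : Continuous s := (continuousOn_iff_continuous_domRestrict.mp hσ.continuousOn).Icc_extend'
  have hd : Continuous d := (continuousOn_iff_continuous_domRestrict.mp
    (hσ.continuousOn_derivWithin (uniqueDiffOn_Icc zero_lt_one) (by norm_num))).Icc_extend'
  have hpos : ∀ y, 0 < s y := fun y => hσpos _ (Set.projIcc (0 : ℝ) 1 zero_le_one y).2
  have hσs : ∀ y ∈ Set.Icc (0 : ℝ) 1, σ y = s y := fun y hy => by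
    rw [hs_def, Set.IccExtend_of_mem _ _ hy, Set.domRestrict_apply]
  have hσd : ∀ y ∈ Set.Ioo (0 : ℝ) 1, deriv σ y = d y := fun y hy => by
    rw [hd_def, Set.IccExtend_of_mem _ _ (Set.Ioo_subset_Icc_self hy), Set.domRestrict_apply,
      derivWithin_of_mem_nhds (Icc_mem_nhds hy.1 hy.2)]
  have hpart : ∀ j η, (∀ p < N j, x j (p + 1) - x j p < η) → IsFinePartition η (N j) (x j) :=
    fun j η h => ⟨hN j, hx0 j, hxN j, hmono j, h⟩
  have hfine : ∀ η > 0, ∀ᶠ j in atTop, IsFinePartition η (N j) (x j) := fun η hη => by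
    filter_upwards [hmesh.eventually_lt_const hη] with j hj
    refine hpart j η fun p hp => ?_
    rw [Finset.sup'_lt_iff] at hj
    exact hj p (Finset.mem_range.mpr hp)
  have hmem : ∀ j, ∀ p ≤ N j, x j p ∈ Set.Icc (0 : ℝ) 1 := fun j p hp => by
    refine (hpart j (∑ p ∈ Finset.range (N j), (x j (p + 1) - x j p) + 1)
      fun q hq => ?_).mem_Icc hp
    refine (Finset.single_le_sum (f := fun p => x j (p + 1) - x j p) (fun i hi => ?_)
      (Finset.mem_range.mpr hq)).trans_lt (lt_add_one _)
    exact sub_nonneg.mpr (hmono j i (Finset.mem_range.mp hi)).le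
  set r : ℕ → ℕ → ℝ := fun j p =>
    (s (x j (p + 1)) - s (x j p)) / (s (x j (p + 1)) + s (x j p)) with hr_def
  have hr : ∀ j, IsReflection s d (N j) (x j) (r j) := fun j p _ hp => by
    have ha := hmem j p hp.le
    have hb := hmem j (p + 1) hp
    have hlt := hmono j p hp
    obtain ⟨ξ, hξ, hslope⟩ := exists_deriv_eq_slope σ hlt
      (hσ.continuousOn.mono (Set.Icc_subset_Icc ha.1 hb.2))
      (((hσ.differentiableOn (by norm_num)).mono Set.Ioo_subset_Icc_self).mono
        (Set.Ioo_subset_Ioo ha.1 hb.2))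
    refine ⟨ξ, Set.Ioo_subset_Icc_self hξ, ?_⟩
    rw [← hσd ξ ⟨ha.1.trans_lt hξ.1, hξ.2.trans_le hb.2⟩, hslope, hσs _ ha, hσs _ hb,
      mul_div_assoc', mul_div_cancel₀ _ (sub_pos.mpr hlt).ne', add_comm (s (x j p))]
  have hD : ∀ j, Dsum σ k (N j) (x j) =
      (∑ b, pathSum (-(k * Complex.I)) (r j) (fun p => (x j p - x j (p - 1)) / s (x j p)) (N j) b -
        ∑ b, pathSum (k * Complex.I) (r j) (fun p => (x j p - x j (p - 1)) / s (x j p)) (N j) b) *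
        Complex.I / 2 := fun j => by
    refine Dsum_eq_pathSum k (fun p hp => ?_) (fun p hp => ?_) fun p hp => ?_
    · rw [Finset.mem_Ico] at hp
      exact (add_pos (hσpos _ (hmem j _ hp.2)) (hσpos _ (hmem j _ hp.2.le))).ne'
    · rw [Finset.mem_Ico] at hp
      rw [hσs _ (hmem j _ hp.2), hσs _ (hmem j _ hp.2.le)]
    · rw [hσs _ (hmem j _ (Finset.mem_Icc.mp hp).2)]
  simp only [hD, Δfun_eq hs hpos hd hσs hσd]
  exact (((tendsto_pathSum hs hpos hd _ hfine hr).sub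
    (tendsto_pathSum hs hpos hd _ hfine hr)).mul_const _).div_const _
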